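/- arXiv:2310.05331 — 3 statements merged into one kernel-verified Lean document; each statement's English description precedes it below -/
import Mathlib

section
/- The sum over unmasked coordinates of the squared difference between the remain-data solution and the full-data solution satisfies Σ_{j∉M} (w*_{r,j} − w*_j)² ≤ 2c₂ · Σ_{j∉M} 1/F_{r,jj}² + 2c₁ · Σ_{j∉M} (1/F_{jj}²)·(F_{f,jj}/F_{r,jj})², where c₁ = max_j b_{r,j}² and c₂ = max_j b_{f,j}². -/
/-- The sum over unmasked coordinates of the squared difference between the remain-data
solution and the full-data solution satisfies
`Σ_{j∉M} (w*_{r,j} − w*_j)² ≤ 2c₂ · Σ_{j∉M} 1/F_{r,jj}² + 2c₁ · Σ_{j∉M} (1/F_{jj}²)·(F_{f,jj}/F_{r,jj})²`,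
where `c₁ = max_j b_{r,j}²` and `c₂ = max_j b_{f,j}²`. -/
theorem statement2
    (N d : ℕ) (x : Fin N → Fin d → ℝ) (y : Fin N → ℝ)
    (R Fs : Finset (Fin N)) (hunion : R ∪ Fs = Finset.univ) (hdisj : Disjoint R Fs)
    (F Fr Ff b br bf : Fin d → ℝ)
    (hF : ∀ j, F j = ∑ i, (x i j) ^ 2)
    (hFr : ∀ j, Fr j = ∑ i ∈ R, (x i j) ^ 2)
    (hFf : ∀ j, Ff j = ∑ i ∈ Fs, (x i j) ^ 2)
    (hb : ∀ j, b j = ∑ i, y i * x i j)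
    (hbr : ∀ j, br j = ∑ i ∈ R, y i * x i j)
    (hbf : ∀ j, bf j = ∑ i ∈ Fs, y i * x i j)
    (hFrpos : ∀ j, 0 < Fr j) (hFfpos : ∀ j, 0 < Ff j)
    (M : Finset (Fin d))
    (c1 : ℝ) (hc1 : IsGreatest (Set.range fun j => (br j) ^ 2) c1)
    (c2 : ℝ) (hc2 : IsGreatest (Set.range fun j => (bf j) ^ 2) c2) :
    ∑ j ∈ Mᶜ, (br j / Fr j - b j / F j) ^ 2 ≤
      2 * c2 * ∑ j ∈ Mᶜ, 1 / (Fr j) ^ 2 +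
        2 * c1 * ∑ j ∈ Mᶜ, (1 / (F j) ^ 2) * (Ff j / Fr j) ^ 2 := by
  rw [Finset.mul_sum, Finset.mul_sum, ← Finset.sum_add_distrib]
  apply Finset.sum_le_sum
  intro j _
  have h1 : br j ^ 2 ≤ c1 := hc1.2 ⟨j, rfl⟩
  have h2 : bf j ^ 2 ≤ c2 := hc2.2 ⟨j, rfl⟩
  have eF : F j = Fr j + Ff j := by
    rw [hF, hFr, hFf, ← Finset.sum_union hdisj, hunion]
  have eb : b j = br j + bf j := by
    rw [hb, hbr, hbf, ← Finset.sum_union hdisj, hunion]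
  have p1 := hFrpos j
  have p2 := hFfpos j
  have pF : 0 < F j := by rw [eF]; positivity
  have key : br j / Fr j - b j / F j = br j * (1 / F j * (Ff j / Fr j)) - bf j * (1 / F j) := by
    rw [eb]
    field_simp
    rw [eF]
    ring
  have h3 : 1 / F j ^ 2 ≤ 1 / Fr j ^ 2 := by
    apply one_div_le_one_div_of_le (by positivity)
    apply pow_le_pow_left₀ p1.le
    linarith
  have h4 : bf j ^ 2 * (1 / F j ^ 2) ≤ c2 * (1 / Fr j ^ 2) :=
    mul_le_mul h2 h3 (by positivity) ((sq_nonneg _).trans h2)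
  have h5 : br j ^ 2 * (1 / F j ^ 2 * (Ff j / Fr j) ^ 2) ≤ c1 * (1 / F j ^ 2 * (Ff j / Fr j) ^ 2) :=
    mul_le_mul_of_nonneg_right h1 (by positivity)
  have h6 : (br j * (1 / F j * (Ff j / Fr j)) - bf j * (1 / F j)) ^ 2 ≤
      2 * (bf j ^ 2 * (1 / F j ^ 2)) + 2 * (br j ^ 2 * (1 / F j ^ 2 * (Ff j / Fr j) ^ 2)) := by
    have e : 1 / F j ^ 2 = (1 / F j) ^ 2 := by rw [div_pow, one_pow]
    rw [e]
    have := sq_nonneg (br j * (1 / F j * (Ff j / Fr j)) + bf j * (1 / F j))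
    linarith
  rw [key]
  linarith
end

section
/- The squared Euclidean distance between the remain-data solution w*_r and the masked full-data solution ŵ_r is bounded: Σ_{j∈M} (w*_{r,j})² + Σ_{j∉M} (w*_{r,j} − w*_j)² ≤ c + 2c₁ · Σ_{j∉M} (1/F_{jj}²)·(F_{f,jj}/F_{r,jj})², where c = max{c₁, 2c₂} · Σ_{j=1}^d 1/F_{r,jj}², c₁ = max_j b_{r,j}², and c₂ = max_j b_{f,j}². Equivalently, ‖w*_r − ŵ_r‖² is bounded by this quantity, where ŵ_{r,j} = 0 for j ∈ M and ŵ_{r,j} = w*_j for j ∉ M. -/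
/-- The squared Euclidean distance between the remain-data solution `w*_r` and the masked
full-data solution `ŵ_r` is bounded:
`Σ_{j∈M} (w*_{r,j})² + Σ_{j∉M} (w*_{r,j} − w*_j)² ≤ c + 2c₁ · Σ_{j∉M} (1/F_{jj}²)·(F_{f,jj}/F_{r,jj})²`,
with `c = max{c₁, 2c₂} · Σ_j 1/F_{r,jj}²`; equivalently `‖w*_r − ŵ_r‖²` is bounded by the
same quantity, where `ŵ_{r,j} = 0` for `j ∈ M` and `ŵ_{r,j} = w*_j` otherwise. -/
theorem statement3
    (N d : ℕ) (x : Fin N → Fin d → ℝ) (y : Fin N → ℝ)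
    (R Fs : Finset (Fin N)) (hunion : R ∪ Fs = Finset.univ) (hdisj : Disjoint R Fs)
    (F Fr Ff b br bf : Fin d → ℝ)
    (hF : ∀ j, F j = ∑ i, (x i j) ^ 2)
    (hFr : ∀ j, Fr j = ∑ i ∈ R, (x i j) ^ 2)
    (hFf : ∀ j, Ff j = ∑ i ∈ Fs, (x i j) ^ 2)
    (hb : ∀ j, b j = ∑ i, y i * x i j)
    (hbr : ∀ j, br j = ∑ i ∈ R, y i * x i j)
    (hbf : ∀ j, bf j = ∑ i ∈ Fs, y i * x i j)
    (hFrpos : ∀ j, 0 < Fr j) (hFfpos : ∀ j, 0 < Ff j)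
    (M : Finset (Fin d))
    (what : Fin d → ℝ) (hwhat : ∀ j, what j = if j ∈ M then 0 else b j / F j)
    (c1 : ℝ) (hc1 : IsGreatest (Set.range fun j => (br j) ^ 2) c1)
    (c2 : ℝ) (hc2 : IsGreatest (Set.range fun j => (bf j) ^ 2) c2)
    (c : ℝ) (hc : c = max c1 (2 * c2) * ∑ j, 1 / (Fr j) ^ 2) :
    (∑ j ∈ M, (br j / Fr j) ^ 2 + ∑ j ∈ Mᶜ, (br j / Fr j - b j / F j) ^ 2 ≤
        c + 2 * c1 * ∑ j ∈ Mᶜ, (1 / (F j) ^ 2) * (Ff j / Fr j) ^ 2) ∧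
      ∑ j, (br j / Fr j - what j) ^ 2 ≤
        c + 2 * c1 * ∑ j ∈ Mᶜ, (1 / (F j) ^ 2) * (Ff j / Fr j) ^ 2 := by
  have hFs : ∀ j, F j = Fr j + Ff j := by
    intro j
    rw [hF, hFr, hFf, ← Finset.sum_union hdisj, hunion]
  have hbs : ∀ j, b j = br j + bf j := by
    intro j
    rw [hb, hbr, hbf, ← Finset.sum_union hdisj, hunion]
  have h1 : ∀ j, br j ^ 2 ≤ c1 := fun j => hc1.2 ⟨j, rfl⟩
  have h2 : ∀ j, bf j ^ 2 ≤ c2 := fun j => hc2.2 ⟨j, rfl⟩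
  have key : ∑ j ∈ M, (br j / Fr j) ^ 2 + ∑ j ∈ Mᶜ, (br j / Fr j - b j / F j) ^ 2 ≤
      c + 2 * c1 * ∑ j ∈ Mᶜ, (1 / (F j) ^ 2) * (Ff j / Fr j) ^ 2 := by
    have hM : ∑ j ∈ M, (br j / Fr j) ^ 2 ≤ ∑ j ∈ M, max c1 (2 * c2) * (1 / (Fr j) ^ 2) := by
      apply Finset.sum_le_sum
      intro j _
      rw [div_pow, div_eq_mul_one_div]
      exact mul_le_mul_of_nonneg_right ((h1 j).trans (le_max_left _ _)) (by positivity)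
    have hMc : ∑ j ∈ Mᶜ, (br j / Fr j - b j / F j) ^ 2 ≤
        ∑ j ∈ Mᶜ, (max c1 (2 * c2) * (1 / (Fr j) ^ 2) +
          2 * c1 * ((1 / (F j) ^ 2) * (Ff j / Fr j) ^ 2)) := by
      apply Finset.sum_le_sum
      intro j _
      have hr := hFrpos j
      have hf := hFfpos j
      have hFp : 0 < F j := by rw [hFs]; positivity
      have e : br j / Fr j - b j / F j = br j * (1 / F j * (Ff j / Fr j)) - bf j * (1 / F j) := by
        have hne : Fr j + Ff j ≠ 0 := by positivity
        rw [hbs, hFs]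
        field_simp
        ring
      have a1 : br j ^ 2 * (1 / F j * (Ff j / Fr j)) ^ 2 ≤ c1 * (1 / F j * (Ff j / Fr j)) ^ 2 :=
        mul_le_mul_of_nonneg_right (h1 j) (by positivity)
      have a2 : 2 * bf j ^ 2 * (1 / F j ^ 2) ≤ max c1 (2 * c2) * (1 / Fr j ^ 2) := by
        have hm : 2 * bf j ^ 2 ≤ max c1 (2 * c2) :=
          le_trans (by linarith [h2 j]) (le_max_right _ _)
        have hle : Fr j ≤ F j := by rw [hFs]; linarith
        have hinv : 1 / F j ^ 2 ≤ 1 / Fr j ^ 2 :=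
          one_div_le_one_div_of_le (by positivity) (pow_le_pow_left₀ hr.le hle 2)
        exact mul_le_mul hm hinv (by positivity) (le_trans (by positivity) hm)
      have e1 : (1 / F j * (Ff j / Fr j)) ^ 2 = 1 / F j ^ 2 * (Ff j / Fr j) ^ 2 := by
        rw [mul_pow, div_pow 1, one_pow]
      have e2 : (bf j * (1 / F j)) ^ 2 = bf j ^ 2 * (1 / F j ^ 2) := by
        rw [mul_pow, div_pow 1, one_pow]
      have e3 : (br j * (1 / F j * (Ff j / Fr j))) ^ 2 =
          br j ^ 2 * (1 / F j * (Ff j / Fr j)) ^ 2 := mul_pow _ _ _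
      rw [e, ← e1]
      have := sq_nonneg (br j * (1 / F j * (Ff j / Fr j)) + bf j * (1 / F j))
      linarith [sub_sq (br j * (1 / F j * (Ff j / Fr j))) (bf j * (1 / F j)),
        add_sq (br j * (1 / F j * (Ff j / Fr j))) (bf j * (1 / F j))]
    rw [Finset.sum_add_distrib, ← Finset.mul_sum, ← Finset.mul_sum] at hMc
    rw [← Finset.mul_sum] at hM
    rw [hc, ← Finset.sum_add_sum_compl M (fun j => 1 / Fr j ^ 2), mul_add]
    linarith
  refine ⟨key, ?_⟩
  have e : ∑ j, (br j / Fr j - what j) ^ 2 =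
      ∑ j ∈ M, (br j / Fr j) ^ 2 + ∑ j ∈ Mᶜ, (br j / Fr j - b j / F j) ^ 2 := by
    rw [← Finset.sum_add_sum_compl M]
    congr 1
    · apply Finset.sum_congr rfl
      intro j hj
      rw [hwhat, if_pos hj, sub_zero]
    · apply Finset.sum_congr rfl
      intro j hj
      rw [hwhat, if_neg (Finset.mem_compl.mp hj)]
  rw [e]
  exact key
end

section
/- (Proposition 1, quadratic-form version) The Fisher quadratic form between the remain-data solution and the masked model satisfies (1/2)·(w*_r − ŵ_r)ᵀ F (w*_r − ŵ_r) ≤ (λ/(2N)) · ( c + 2c₁ · Σ_{j∉M} (1/F_{jj}²)·(F_{f,jj}/F_{r,jj})² ), where F = (1/N)·X Xᵀ is the empirical Fisher matrix, λ is the largest eigenvalue of X Xᵀ, c₁ = max_j b_{r,j}², c₂ = max_j b_{f,j}², and c = max{c₁, 2c₂} · Σ_{j=1}^d 1/F_{r,jj}². -/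
open Matrix

theorem rayleigh_aux {d : ℕ} (A : Matrix (Fin d) (Fin d) ℝ) (hA : A.IsHermitian) (lam : ℝ)
    (hlam : ∀ μ, Module.End.HasEigenvalue (Matrix.toLin' A) μ → μ ≤ lam) (v : Fin d → ℝ) :
    v ⬝ᵥ (A *ᵥ v) ≤ lam * (v ⬝ᵥ v) := by
  have hB : (lam • (1 : Matrix (Fin d) (Fin d) ℝ) - A).IsHermitian := by
    refine Matrix.IsHermitian.sub ?_ hA
    simp [Matrix.IsHermitian]
  have hP : (lam • (1 : Matrix (Fin d) (Fin d) ℝ) - A).PosSemidef := by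
    rw [hB.posSemidef_iff_eigenvalues_nonneg]
    intro i
    have h1 := hB.mulVec_eigenvectorBasis i
    have hne : (hB.eigenvectorBasis i).ofLp ≠ 0 := by
      intro h
      exact hB.eigenvectorBasis.toBasis.ne_zero i (by
        ext k
        simpa using congrFun h k)
    have h2 := hlam (lam - hB.eigenvalues i) (Module.End.hasEigenvalue_of_hasEigenvector
      (x := (hB.eigenvectorBasis i).ofLp) ⟨by
        rw [Module.End.mem_eigenspace_iff, Matrix.toLin'_apply]
        rw [Matrix.sub_mulVec, Matrix.smul_mulVec, Matrix.one_mulVec] at h1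
        rw [sub_smul, ← h1]
        abel, hne⟩)
    simp only [Pi.zero_apply]
    linarith
  have h3 := hP.dotProduct_mulVec_nonneg v
  rw [Matrix.sub_mulVec, Matrix.smul_mulVec, Matrix.one_mulVec, star_trivial, dotProduct_sub,
    dotProduct_smul, smul_eq_mul] at h3
  linarith

/-- (Proposition 1, quadratic-form version) The Fisher quadratic form between the
remain-data solution and the masked model satisfies
`(1/2)·(w*_r − ŵ_r)ᵀ F (w*_r − ŵ_r) ≤ (λ/(2N)) · (c + 2c₁ · Σ_{j∉M} (1/F_{jj}²)·(F_{f,jj}/F_{r,jj})²)`,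
where `F = (1/N)·X Xᵀ` and `λ` is the largest eigenvalue of `X Xᵀ`. -/
theorem statement4
    (N d : ℕ) (hN : 0 < N) (x : Fin N → Fin d → ℝ) (y : Fin N → ℝ)
    (X : Matrix (Fin d) (Fin N) ℝ) (hX : ∀ j i, X j i = x i j)
    (R Fs : Finset (Fin N)) (hunion : R ∪ Fs = Finset.univ) (hdisj : Disjoint R Fs)
    (F Fr Ff b br bf : Fin d → ℝ)
    (hF : ∀ j, F j = ∑ i, (x i j) ^ 2)
    (hFr : ∀ j, Fr j = ∑ i ∈ R, (x i j) ^ 2)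
    (hFf : ∀ j, Ff j = ∑ i ∈ Fs, (x i j) ^ 2)
    (hb : ∀ j, b j = ∑ i, y i * x i j)
    (hbr : ∀ j, br j = ∑ i ∈ R, y i * x i j)
    (hbf : ∀ j, bf j = ∑ i ∈ Fs, y i * x i j)
    (hFrpos : ∀ j, 0 < Fr j) (hFfpos : ∀ j, 0 < Ff j)
    (wstar wr : Fin d → ℝ)
    (hwstar : ∀ j, wstar j = b j / F j)
    (hwr : ∀ j, wr j = br j / Fr j)
    (M : Finset (Fin d))
    (what : Fin d → ℝ) (hwhat : ∀ j, what j = if j ∈ M then 0 else wstar j)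
    (Fmat : Matrix (Fin d) (Fin d) ℝ) (hFmat : Fmat = (N : ℝ)⁻¹ • (X * Xᵀ))
    (lam : ℝ)
    (hlam : IsGreatest {μ : ℝ | Module.End.HasEigenvalue (Matrix.toLin' (X * Xᵀ)) μ} lam)
    (c1 : ℝ) (hc1 : IsGreatest (Set.range fun j => (br j) ^ 2) c1)
    (c2 : ℝ) (hc2 : IsGreatest (Set.range fun j => (bf j) ^ 2) c2)
    (c : ℝ) (hc : c = max c1 (2 * c2) * ∑ j, 1 / (Fr j) ^ 2) :
    (1 / 2) * ((wr - what) ⬝ᵥ (Fmat *ᵥ (wr - what))) ≤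
      lam / (2 * N) * (c + 2 * c1 * ∑ j ∈ Mᶜ, (1 / (F j) ^ 2) * (Ff j / Fr j) ^ 2) := by
  have hA : (X * Xᵀ).IsHermitian := by
    simpa using Matrix.isHermitian_mul_conjTranspose_self X
  have hray := rayleigh_aux (X * Xᵀ) hA lam (fun μ h => hlam.2 h)
  have hNpos : (0 : ℝ) < N := by exact_mod_cast hN
  have hquad : ∀ v : Fin d → ℝ, 0 ≤ v ⬝ᵥ ((X * Xᵀ) *ᵥ v) := by
    intro v
    have h := (Matrix.posSemidef_self_mul_conjTranspose X).dotProduct_mulVec_nonneg v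
    simpa using h
  have hlam0 : 0 ≤ lam := by
    obtain ⟨j, -⟩ := hc1.1
    have h1 := hray (Pi.single j 1)
    have h2 := hquad (Pi.single j 1)
    have h3 : (Pi.single j (1 : ℝ) : Fin d → ℝ) ⬝ᵥ Pi.single j 1 = 1 := by simp
    rw [h3] at h1
    linarith
  have hFsum : ∀ j, F j = Fr j + Ff j := by
    intro j
    rw [hF, hFr, hFf, ← hunion, Finset.sum_union hdisj]
  have hbsum : ∀ j, b j = br j + bf j := by
    intro j
    rw [hb, hbr, hbf, ← hunion, Finset.sum_union hdisj]
  have hbr1 : ∀ j, br j ^ 2 ≤ c1 := fun j => hc1.2 ⟨j, rfl⟩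
  have hbf2 : ∀ j, bf j ^ 2 ≤ c2 := fun j => hc2.2 ⟨j, rfl⟩
  have hnorm : (wr - what) ⬝ᵥ (wr - what) ≤
      c + 2 * c1 * ∑ j ∈ Mᶜ, (1 / (F j) ^ 2) * (Ff j / Fr j) ^ 2 := by
    have hs : ∑ j ∈ Mᶜ, (1 / (F j) ^ 2) * (Ff j / Fr j) ^ 2 =
        ∑ j, if j ∈ M then 0 else (1 / (F j) ^ 2) * (Ff j / Fr j) ^ 2 := by
      rw [← Finset.sum_subset (Finset.subset_univ Mᶜ)]
      · refine Finset.sum_congr rfl fun j hj => ?_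
        rw [if_neg (Finset.mem_compl.mp hj)]
      · intro j _ hj
        rw [if_pos (by simpa using hj)]
    rw [hs, hc, Finset.mul_sum, Finset.mul_sum, ← Finset.sum_add_distrib]
    unfold dotProduct
    refine Finset.sum_le_sum fun j _ => ?_
    have hr := hFrpos j
    have hf := hFfpos j
    have hFj : 0 < F j := by rw [hFsum]; positivity
    have hi : 0 ≤ 1 / (Fr j) ^ 2 := by positivity
    rw [Pi.sub_apply, hwhat, hwr]
    by_cases hj : j ∈ M
    · simp only [hj, if_true]
      calc _ = br j ^ 2 * (1 / Fr j ^ 2) := by field_simp; ring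
        _ ≤ max c1 (2 * c2) * (1 / Fr j ^ 2) :=
          mul_le_mul_of_nonneg_right ((hbr1 j).trans (le_max_left _ _)) hi
        _ = _ := by ring
    · simp only [hj, if_false]
      rw [hwstar, hbsum]
      have e : br j / Fr j - (br j + bf j) / F j =
          br j * (1 / F j * (Ff j / Fr j)) - bf j * (1 / F j) := by
        have : Ff j = F j - Fr j := by rw [hFsum]; ring
        rw [this]
        field_simp
        ring
      rw [e]
      have h1 : br j ^ 2 * (1 / F j * (Ff j / Fr j)) ^ 2 ≤
          c1 * (1 / F j * (Ff j / Fr j)) ^ 2 :=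
        mul_le_mul_of_nonneg_right (hbr1 j) (sq_nonneg _)
      have hle : 1 / F j ^ 2 ≤ 1 / Fr j ^ 2 := by
        apply one_div_le_one_div_of_le (by positivity)
        have := hFsum j
        gcongr
        linarith
      have h2 : 2 * bf j ^ 2 * (1 / F j ^ 2) ≤ max c1 (2 * c2) * (1 / Fr j ^ 2) := by
        have h5 : 2 * bf j ^ 2 ≤ max c1 (2 * c2) :=
          le_trans (by linarith [hbf2 j]) (le_max_right _ _)
        exact mul_le_mul h5 hle (by positivity) (le_trans (by positivity) h5)
      have e2 : (1 / F j) ^ 2 = 1 / F j ^ 2 := by rw [div_pow, one_pow]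
      rw [← e2] at h2 ⊢
      nlinarith [sq_nonneg (br j * (1 / F j * (Ff j / Fr j)) + bf j * (1 / F j))]
  have h1 := hray (wr - what)
  rw [hFmat, Matrix.smul_mulVec, dotProduct_smul, smul_eq_mul]
  calc _ = (1 / (2 * N)) * ((wr - what) ⬝ᵥ ((X * Xᵀ) *ᵥ (wr - what))) := by field_simp
    _ ≤ (1 / (2 * N)) * (lam * (c + 2 * c1 * ∑ j ∈ Mᶜ, (1 / (F j) ^ 2) * (Ff j / Fr j) ^ 2)) := by
      refine mul_le_mul_of_nonneg_left (h1.trans ?_) (by positivity)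
      exact mul_le_mul_of_nonneg_left hnorm hlam0
    _ = _ := by ring
end
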